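/- arXiv:1910.05010 — 5 statements merged into one kernel-verified Lean document; each statement's English description precedes it below -/
import Mathlib

section
/- The value ζ(3) of the Riemann zeta function at 3, i.e. the sum Σ_{n=1}^∞ 1/n³, is an irrational real number. -/
open Finset Filter Topology

namespace Apery

open Nat (lcmUpto lcmUpto_ne_zero lcmUpto_pos factorization_lcmUpto)

/-- The product `(n choose k) * ((n + k) choose k)`, as a real number. -/
noncomputable def lam (n k : ℕ) : ℝ := (n.choose k : ℝ) * ((n + k).choose k : ℝ)

lemma lam_zero_right (n : ℕ) : lam n 0 = 1 := by simp [lam]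

lemma lam_eq_zero {n k : ℕ} (h : n < k) : lam n k = 0 := by
  simp [lam, Nat.choose_eq_zero_of_lt h]

lemma one_le_lam {n k : ℕ} (h : k ≤ n) : 1 ≤ lam n k := by
  have h1 : 1 ≤ n.choose k * (n + k).choose k :=
    Nat.mul_pos (Nat.choose_pos h) (Nat.choose_pos (Nat.le_add_left k n))
  unfold lam
  exact_mod_cast h1

lemma lam_ne_zero {n k : ℕ} (h : k ≤ n) : lam n k ≠ 0 :=
  (one_pos.trans_le (one_le_lam h)).ne'

lemma lam_nonneg (n k : ℕ) : 0 ≤ lam n k := by unfold lam; positivity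

lemma lam_succ_left (n k : ℕ) :
    ((n : ℝ) + 1 - k) * lam (n + 1) k = (n + 1 + k) * lam n k := by
  rcases lt_or_ge (n + 1) k with h | h
  · rw [lam_eq_zero h, lam_eq_zero (by omega : n < k)]; simp
  have h1 := congrArg (Nat.cast : ℕ → ℝ) (Nat.choose_mul_succ_eq n k)
  have h2 := congrArg (Nat.cast : ℕ → ℝ) (Nat.choose_mul_succ_eq (n + k) k)
  rw [show n + k + 1 - k = n + 1 by omega] at h2
  push_cast [Nat.cast_sub h] at h1 h2
  have h3 : (n : ℝ) + 1 ≠ 0 := by positivity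
  unfold lam
  rw [show n + 1 + k = n + k + 1 by ring]
  apply mul_left_cancel₀ h3
  linear_combination (-((n + k + 1).choose k : ℝ) * (n + 1)) * h1 -
    ((n.choose k : ℝ) * (n + 1)) * h2

lemma lam_succ_right (n k : ℕ) :
    ((k : ℝ) + 1) ^ 2 * lam n (k + 1) = (n - k) * (n + k + 1) * lam n k := by
  rcases lt_or_ge n k with h | h
  · rw [lam_eq_zero h, lam_eq_zero (by omega : n < k + 1)]; simp
  have h1 := congrArg (Nat.cast : ℕ → ℝ) (Nat.choose_succ_right_eq n k)
  have h2 := congrArg (Nat.cast : ℕ → ℝ) (Nat.add_one_mul_choose_eq (n + k) k)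
  push_cast [Nat.cast_sub h] at h1 h2
  unfold lam
  rw [← add_assoc]
  linear_combination (((n + k + 1).choose (k + 1) : ℝ) * (k + 1)) * h1 -
    ((n.choose k : ℝ) * (n - k)) * h2

lemma lam_add_two_succ (n j : ℕ) : lam (n + 2) (j + 1) =
    lam (n + 1) j * ((n + 2 + j) * (n + 3 + j)) / ((j : ℝ) + 1) ^ 2 := by
  have h1 := lam_succ_right (n + 2) j
  have h2 := lam_succ_left (n + 1) j
  rw [eq_div_iff (by positivity)]
  push_cast at h1 h2
  linear_combination h1 + ((n : ℝ) + 3 + j) * h2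

lemma lam_succ_succ (n j : ℕ) : lam (n + 1) (j + 1) =
    lam (n + 1) j * ((n + 1 - j) * (n + 2 + j)) / ((j : ℝ) + 1) ^ 2 := by
  have h1 := lam_succ_right (n + 1) j
  rw [eq_div_iff (by positivity)]
  push_cast at h1
  linear_combination h1

lemma lam_succ_right' (n j : ℕ) : lam n (j + 1) =
    lam (n + 1) j * ((n - j) * (n + 1 - j)) / ((j : ℝ) + 1) ^ 2 := by
  have h1 := lam_succ_right n j
  have h2 := lam_succ_left n j
  rw [eq_div_iff (by positivity)]
  linear_combination h1 - ((n : ℝ) - j) * h2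

/-- The Apéry numbers. -/
noncomputable def a (n : ℕ) : ℝ := ∑ k ∈ range (n + 1), lam n k ^ 2

/-- The partial sums `∑ 1 / m ^ 3`, corrected by an alternating sum of length `k`. -/
noncomputable def c (n k : ℕ) : ℝ := ∑ m ∈ range n, 1 / ((m : ℝ) + 1) ^ 3 +
  ∑ m ∈ range k, (-1) ^ m / (2 * ((m : ℝ) + 1) ^ 3 * lam n (m + 1))

/-- The numerators of the Apéry approximations `b n / a n` to `ζ(3)`. -/
noncomputable def b (n : ℕ) : ℝ := ∑ k ∈ range (n + 1), lam n k ^ 2 * c n k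

lemma sum_lam_sq_mul_eq {n N : ℕ} (h : n + 1 ≤ N) (f : ℕ → ℝ) :
    ∑ k ∈ range (n + 1), lam n k ^ 2 * f k = ∑ k ∈ range N, lam n k ^ 2 * f k := by
  refine sum_subset (range_subset_range.2 h) fun k _ hk => ?_
  rw [lam_eq_zero (by simpa using hk)]
  simp

lemma c_succ_right (n k : ℕ) :
    c n (k + 1) = c n k + (-1) ^ k / (2 * ((k : ℝ) + 1) ^ 3 * lam n (k + 1)) := by
  rw [c, c, sum_range_succ]; ring

lemma c_succ_left {n k : ℕ} (h : k ≤ n) :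
    c (n + 1) k = c n k + (-1) ^ k / (((n : ℝ) + 1) ^ 2 * (n + 1 + k) * lam n k) := by
  induction k with
  | zero =>
    simp only [c, sum_range_succ, range_zero, sum_empty, lam_zero_right]
    have : (n : ℝ) + 1 ≠ 0 := by positivity
    push_cast
    field_simp
    ring
  | succ k ih =>
    have hk : (k : ℝ) + 1 ≤ n := by exact_mod_cast h
    have h1 : (n : ℝ) - k ≠ 0 := by
      have : 0 < (n : ℝ) - k := by linarith
      exact this.ne'
    have h2 : (n : ℝ) + 1 - k ≠ 0 := by
      have : 0 < (n : ℝ) + 1 - k := by linarith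
      exact this.ne'
    have ht : lam (n + 1) k ≠ 0 := lam_ne_zero (by omega)
    have h3 : lam n k = lam (n + 1) k * (n + 1 - k) / (n + 1 + k) := by
      rw [eq_div_iff (by positivity)]
      linear_combination - lam_succ_left n k
    rw [c_succ_right, c_succ_right, ih (by omega), lam_succ_succ, lam_succ_right', h3]
    have : (n : ℝ) + 1 + k ≠ 0 := by positivity
    have : (n : ℝ) + 2 + k ≠ 0 := by positivity
    push_cast
    rw [show (n : ℝ) + 1 + (k + 1) = n + 2 + k by ring]
    field_simp
    ring

/-- The certificate for the recurrence of the sum of the `lam n k ^ 2`. -/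
noncomputable def certA (n k : ℕ) : ℝ :=
  4 * (2 * n + 3) * (k * (2 * k + 1) - (2 * n + 3) ^ 2) * lam (n + 1) k ^ 2

/-- The certificate for the recurrence of the sum of the `lam n k ^ 2 * c n k`. -/
noncomputable def certB (n k : ℕ) : ℝ := certA n k * c (n + 1) k -
  5 * (2 * n + 3) * k * (-1) ^ k / ((n + 1) * (n + 2)) * lam (n + 1) k

/-- The middle coefficient of the Apéry recurrence. -/
noncomputable def midCoeff (n : ℕ) : ℝ :=
  34 * ((n : ℝ) + 1) ^ 3 + 51 * ((n : ℝ) + 1) ^ 2 + 27 * ((n : ℝ) + 1) + 5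

lemma certA_succ (n j : ℕ) :
    ((n : ℝ) + 2) ^ 3 * lam (n + 2) (j + 1) ^ 2 - midCoeff n * lam (n + 1) (j + 1) ^ 2 +
      ((n : ℝ) + 1) ^ 3 * lam n (j + 1) ^ 2 = certA n (j + 1) - certA n j := by
  rw [certA, certA, midCoeff, lam_add_two_succ, lam_succ_succ, lam_succ_right']
  push_cast
  field_simp
  ring

lemma certB_succ {n j : ℕ} (hj : j ≤ n + 1) :
    ((n : ℝ) + 2) ^ 3 * (lam (n + 2) (j + 1) ^ 2 * c (n + 2) (j + 1)) -
      midCoeff n * (lam (n + 1) (j + 1) ^ 2 * c (n + 1) (j + 1)) +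
      ((n : ℝ) + 1) ^ 3 * (lam n (j + 1) ^ 2 * c n (j + 1)) = certB n (j + 1) - certB n j := by
  have ht : lam (n + 1) j ≠ 0 := lam_ne_zero hj
  have e1 : lam (n + 1) (j + 1) ^ 2 * c (n + 1) (j + 1) =
      lam (n + 1) (j + 1) ^ 2 * c (n + 1) j +
        lam (n + 1) (j + 1) * (-1) ^ j / (2 * ((j : ℝ) + 1) ^ 3) := by
    rw [c_succ_right]
    rcases eq_or_ne (lam (n + 1) (j + 1)) 0 with h | h
    · simp [h]
    · field_simp
  have e0 : lam n (j + 1) ^ 2 * c n (j + 1) = lam n (j + 1) ^ 2 * c (n + 1) j +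
      lam n (j + 1) * (-1) ^ j * ((n - j) / (n + 2 + j) / (2 * ((j : ℝ) + 1) ^ 3) +
        1 / (((n : ℝ) + 1) ^ 2 * (n + 2 + j))) := by
    rcases lt_or_ge n (j + 1) with h | h
    · simp [lam_eq_zero h]
    have h1 := c_succ_left h
    have h2 := lam_succ_left n (j + 1)
    have h3 : lam n (j + 1) ≠ 0 := lam_ne_zero h
    have h4 : lam (n + 1) (j + 1) ≠ 0 := lam_ne_zero (by omega)
    rw [c_succ_right] at h1
    have h5 : c n (j + 1) = c (n + 1) j +
      (-1) ^ j / (2 * ((j : ℝ) + 1) ^ 3 * lam (n + 1) (j + 1)) -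
      (-1) ^ (j + 1) / (((n : ℝ) + 1) ^ 2 * (n + 2 + j) * lam n (j + 1)) := by
      rw [h1]; push_cast; ring
    have h6 : (lam (n + 1) (j + 1))⁻¹ = (n - j) / (n + 2 + j) * (lam n (j + 1))⁻¹ := by
      push_cast at h2
      field_simp
      linear_combination -h2
    have h7 : (-1) ^ j / (2 * ((j : ℝ) + 1) ^ 3 * lam (n + 1) (j + 1)) =
      (-1) ^ j / (2 * ((j : ℝ) + 1) ^ 3) * (lam (n + 1) (j + 1))⁻¹ := by
      field_simp
    rw [h5, h7, h6]
    field_simp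
    ring
  have e2 : lam (n + 2) (j + 1) ^ 2 * c (n + 2) (j + 1) = lam (n + 2) (j + 1) ^ 2 *
      (c (n + 1) j + (-1) ^ j / (((n : ℝ) + 2) ^ 2 * (n + 2 + j) * lam (n + 1) j)) +
      lam (n + 2) (j + 1) * (-1) ^ j / (2 * ((j : ℝ) + 1) ^ 3) := by
    have h4 : lam (n + 2) (j + 1) ≠ 0 := lam_ne_zero (by omega)
    rw [c_succ_right, c_succ_left hj]
    push_cast
    rw [show (n : ℝ) + 1 + 1 = n + 2 by ring]
    field_simp
  rw [e2, e1, e0, certB, certB, certA, certA, midCoeff, c_succ_right]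
  have e3 : 4 * (2 * (n : ℝ) + 3) * (((j + 1 : ℕ) : ℝ) * (2 * ((j + 1 : ℕ) : ℝ) + 1) -
      (2 * (n : ℝ) + 3) ^ 2) * lam (n + 1) (j + 1) ^ 2 *
      (c (n + 1) j + (-1) ^ j / (2 * ((j : ℝ) + 1) ^ 3 * lam (n + 1) (j + 1))) =
      4 * (2 * (n : ℝ) + 3) * (((j + 1 : ℕ) : ℝ) * (2 * ((j + 1 : ℕ) : ℝ) + 1) -
      (2 * (n : ℝ) + 3) ^ 2) * (lam (n + 1) (j + 1) ^ 2 * c (n + 1) j +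
        lam (n + 1) (j + 1) * (-1) ^ j / (2 * ((j : ℝ) + 1) ^ 3)) := by
    rw [← e1, c_succ_right]; ring
  rw [e3, lam_add_two_succ, lam_succ_succ, lam_succ_right']
  push_cast
  field_simp
  ring

lemma a_recurrence (n : ℕ) :
    ((n : ℝ) + 2) ^ 3 * a (n + 2) - midCoeff n * a (n + 1) + ((n : ℝ) + 1) ^ 3 * a n = 0 := by
  have key : ∀ K : ℕ, ∑ k ∈ range (K + 1), (((n : ℝ) + 2) ^ 3 * lam (n + 2) k ^ 2 -
      midCoeff n * lam (n + 1) k ^ 2 + ((n : ℝ) + 1) ^ 3 * lam n k ^ 2) = certA n K := by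
    intro K
    induction K with
    | zero => simp [certA, midCoeff, lam_zero_right]; ring
    | succ K ih => rw [sum_range_succ, ih, certA_succ]; ring
  have h := key (n + 2)
  have h1 := sum_lam_sq_mul_eq (show n + 1 ≤ n + 2 + 1 by omega) 1
  have h2 := sum_lam_sq_mul_eq (show n + 1 + 1 ≤ n + 2 + 1 by omega) 1
  simp only [Pi.one_apply, mul_one] at h1 h2
  rw [sum_add_distrib, sum_sub_distrib, ← mul_sum, ← mul_sum, ← mul_sum, ← h1, ← h2, certA,
    lam_eq_zero (by omega : n + 1 < n + 2)] at h
  simpa [a] using h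

lemma b_recurrence (n : ℕ) :
    ((n : ℝ) + 2) ^ 3 * b (n + 2) - midCoeff n * b (n + 1) + ((n : ℝ) + 1) ^ 3 * b n = 0 := by
  have key : ∀ K : ℕ, K ≤ n + 2 → ∑ k ∈ range (K + 1),
      (((n : ℝ) + 2) ^ 3 * (lam (n + 2) k ^ 2 * c (n + 2) k) -
      midCoeff n * (lam (n + 1) k ^ 2 * c (n + 1) k) +
        ((n : ℝ) + 1) ^ 3 * (lam n k ^ 2 * c n k)) = certB n K := by
    intro K
    induction K with
    | zero =>
      intro _
      simp [certB, certA, midCoeff, lam_zero_right, c, sum_range_succ]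
      field_simp
      ring
    | succ K ih =>
      intro hK
      rw [sum_range_succ, ih (by omega), certB_succ (by omega)]; ring
  have h := key (n + 2) le_rfl
  have h1 := sum_lam_sq_mul_eq (show n + 1 ≤ n + 2 + 1 by omega) (c n)
  have h2 := sum_lam_sq_mul_eq (show n + 1 + 1 ≤ n + 2 + 1 by omega) (c (n + 1))
  rw [sum_add_distrib, sum_sub_distrib, ← mul_sum, ← mul_sum, ← mul_sum, ← h1, ← h2, certB, certA,
    lam_eq_zero (by omega : n + 1 < n + 2)] at h
  simpa [b] using h

lemma casoratian (n : ℕ) : b (n + 1) * a n - a (n + 1) * b n = 6 / ((n : ℝ) + 1) ^ 3 := by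
  induction n with
  | zero => simp [a, b, c, lam, sum_range_succ]; norm_num
  | succ n ih =>
    have h1 := a_recurrence n
    have h2 := b_recurrence n
    rw [eq_div_iff (by positivity)] at ih ⊢
    push_cast
    linear_combination a (n + 1) * h2 - b (n + 1) * h1 + ih

lemma lcmUpto_dvd_lcmUpto {m n : ℕ} (h : m ≤ n) : lcmUpto m ∣ lcmUpto n :=
  Finset.lcm_mono (Icc_subset_Icc_right h)

lemma dvd_lcmUpto {m n : ℕ} (hm : 1 ≤ m) (h : m ≤ n) : m ∣ lcmUpto n :=
  Finset.dvd_lcm (f := id) (mem_Icc.2 ⟨hm, h⟩)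

lemma mul_choose_add_dvd_lcmUpto (k : ℕ) : ∀ m : ℕ, 1 ≤ m →
    m * (m + k).choose m ∣ lcmUpto (m + k) := by
  induction k with
  | zero => intro m hm; simpa using dvd_lcmUpto hm le_rfl
  | succ k ih =>
    intro m hm
    obtain ⟨x, hx⟩ := (ih m hm).trans (lcmUpto_dvd_lcmUpto (by omega : m + k ≤ m + (k + 1)))
    obtain ⟨y, hy⟩ := ih (m + 1) (by omega)
    rw [show m + 1 + k = m + k + 1 by ring] at hy
    rw [← add_assoc] at hx ⊢
    have h1 := Nat.add_one_mul_choose_eq (m + k) m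
    have h2 := Nat.choose_mul_succ_eq (m + k) m
    rw [show m + k + 1 - m = k + 1 by omega] at h2
    zify at hx hy h1 h2 ⊢
    refine ⟨(x : ℤ) - y, ?_⟩
    have h3 : (k : ℤ) + 1 ≠ 0 := by positivity
    apply mul_left_cancel₀ h3
    linear_combination ((m : ℤ) + k + 1) * hx - m * hy + m * y * h1 + m * (x - y) * h2

lemma mul_choose_dvd_lcmUpto {m n : ℕ} (hm : 1 ≤ m) (h : m ≤ n) :
    m * n.choose m ∣ lcmUpto n := by
  simpa [Nat.add_sub_cancel' h] using mul_choose_add_dvd_lcmUpto (n - m) m hm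

lemma choose_mul_pow_le (x y p q : ℕ) :
    (x + y).choose x * (p ^ x * q ^ y) ≤ (p + q) ^ (x + y) := by
  rw [add_pow]
  have := single_le_sum (f := fun i => p ^ i * q ^ (x + y - i) * (x + y).choose i)
    (fun i _ => Nat.zero_le _) (mem_range.2 (by omega : x < x + y + 1))
  simp only [Nat.add_sub_cancel_left] at this
  linarith

/-- The multinomial coefficient `(42 m)! / ((21 m)! (14 m)! (6 m)! m!)`. -/
def multi (m : ℕ) : ℕ :=
  (42 * m).choose (21 * m) * (21 * m).choose (14 * m) * (7 * m).choose (6 * m)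

lemma multi_mul_factorial (m : ℕ) :
    multi m * ((21 * m).factorial * (14 * m).factorial * (6 * m).factorial * m.factorial) =
      (42 * m).factorial := by
  have h1 := Nat.choose_mul_factorial_mul_factorial (by omega : 21 * m ≤ 42 * m)
  have h2 := Nat.choose_mul_factorial_mul_factorial (by omega : 14 * m ≤ 21 * m)
  have h3 := Nat.choose_mul_factorial_mul_factorial (by omega : 6 * m ≤ 7 * m)
  rw [show 42 * m - 21 * m = 21 * m by omega] at h1
  rw [show 21 * m - 14 * m = 7 * m by omega] at h2
  rw [show 7 * m - 6 * m = m by omega] at h3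
  unfold multi
  calc _ = (42 * m).choose (21 * m) * (21 * m).factorial * ((21 * m).choose (14 * m) *
        (14 * m).factorial * ((7 * m).choose (6 * m) * (6 * m).factorial * m.factorial)) := by ring
    _ = _ := by rw [h3, h2, h1]

lemma multi_ne_zero (m : ℕ) : multi m ≠ 0 := fun h =>
  (42 * m).factorial_ne_zero (by rw [← multi_mul_factorial, h, zero_mul])

lemma multi_le (m : ℕ) : multi m ≤ (2 ^ 22 * 3 ^ 15 * 7 ^ 7) ^ m := by
  have h1 := choose_mul_pow_le (21 * m) (21 * m) 1 1
  have h2 := choose_mul_pow_le (14 * m) (7 * m) 2 1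
  have h3 := choose_mul_pow_le (6 * m) m 6 1
  rw [← add_mul] at h1 h2
  rw [← Nat.add_one_mul] at h3
  norm_num at h1 h2 h3
  refine Nat.le_of_mul_le_mul_right (c := 2 ^ (14 * m) * 6 ^ (6 * m)) ?_ (by positivity)
  calc multi m * (2 ^ (14 * m) * 6 ^ (6 * m)) = (42 * m).choose (21 * m) *
        ((21 * m).choose (14 * m) * 2 ^ (14 * m)) * ((7 * m).choose (6 * m) * 6 ^ (6 * m)) := by
        unfold multi; ring
    _ ≤ 2 ^ (42 * m) * 3 ^ (21 * m) * 7 ^ (7 * m) := by gcongr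
    _ = (2 ^ 22 * 3 ^ 15 * 7 ^ 7) ^ m * (2 ^ (14 * m) * 6 ^ (6 * m)) := by
      simp only [pow_mul, ← mul_pow]
      norm_num

lemma sum_ite_pow_le {p N B : ℕ} (hp : p.Prime) (hN : N ≠ 0) (hB : Nat.log p N < B) :
    ∑ i ∈ Ico 1 B, (if p ^ i ≤ N then 1 else 0) = Nat.log p N := by
  rw [← card_filter]
  have : (Ico 1 B).filter (fun i => p ^ i ≤ N) = Ico 1 (Nat.log p N + 1) := by
    ext i
    simp only [mem_filter, mem_Ico, ← Nat.le_log_iff_pow_le hp.one_lt hN]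
    omega
  rw [this]
  simp

lemma floor_inequality (m q : ℕ) (hq : 0 < q) :
    (if q ≤ 42 * m then 1 else 0) + (21 * m / q + 14 * m / q + 6 * m / q + m / q) ≤
      (if q ≤ m then 1 else 0) + 42 * m / q := by
  have key : ∀ c e : ℕ, 0 < c → c * e = 42 → e * m / q = 42 * m / q / c := by
    intro c e hc h
    rw [Nat.div_div_eq_div_mul, mul_comm q c, ← h, mul_assoc, Nat.mul_div_mul_left _ _ hc]
  have e1 := key 2 21 (by norm_num) (by norm_num)
  have e2 := key 3 14 (by norm_num) (by norm_num)
  have e3 := key 7 6 (by norm_num) (by norm_num)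
  have e4 := key 42 1 (by norm_num) (by norm_num)
  rw [one_mul] at e4
  have h1 : q ≤ 42 * m ↔ 1 ≤ 42 * m / q := by rw [Nat.le_div_iff_mul_le hq, one_mul]
  have h2 : q ≤ m ↔ 1 ≤ m / q := by rw [Nat.le_div_iff_mul_le hq, one_mul]
  simp only [h1, h2, e1, e2, e3, e4]
  generalize 42 * m / q = N
  split_ifs <;> omega

lemma lcmUpto_mul_dvd (m : ℕ) (hm : m ≠ 0) : lcmUpto (42 * m) ∣ lcmUpto m * multi m := by
  rw [← Nat.factorization_prime_le_iff_dvd (lcmUpto_ne_zero _)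
    (mul_ne_zero (lcmUpto_ne_zero _) (multi_ne_zero _))]
  intro p hp
  rw [Nat.factorization_mul (lcmUpto_ne_zero _) (multi_ne_zero _), Finsupp.add_apply,
    factorization_lcmUpto _ hp, factorization_lcmUpto _ hp]
  have hlog : ∀ j ≤ 42 * m, Nat.log p j < Nat.log p (42 * m) + 1 := fun j hj =>
    Nat.lt_succ_of_le (Nat.log_mono_right hj)
  have hf := congrArg (fun x => x.factorization p) (multi_mul_factorial m)
  have f0 := fun j : ℕ => j.factorial_ne_zero
  simp only [Nat.factorization_mul, multi_ne_zero, f0, ne_eq, not_false_eq_true, mul_ne_zero,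
    Finsupp.add_apply, mul_eq_zero, or_self] at hf
  rw [Nat.factorization_factorial hp (hlog _ (by omega : 21 * m ≤ 42 * m)),
    Nat.factorization_factorial hp (hlog _ (by omega : 14 * m ≤ 42 * m)),
    Nat.factorization_factorial hp (hlog _ (by omega : 6 * m ≤ 42 * m)),
    Nat.factorization_factorial hp (hlog _ (by omega : m ≤ 42 * m)),
    Nat.factorization_factorial hp (hlog _ le_rfl)] at hf
  have hs := sum_le_sum fun i (_ : i ∈ Ico 1 (Nat.log p (42 * m) + 1)) =>
    floor_inequality m (p ^ i) (pow_pos hp.pos i)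
  simp only [sum_add_distrib] at hs
  rw [sum_ite_pow_le hp (by omega) (hlog _ le_rfl),
    sum_ite_pow_le hp hm (hlog _ (by omega : m ≤ 42 * m))] at hs
  omega

lemma lcmUpto_add_le (n r : ℕ) : lcmUpto (n + r) ≤ lcmUpto n * (n + r) ^ r := by
  induction r with
  | zero => simp
  | succ r ih =>
    have h : lcmUpto (n + (r + 1)) ∣ lcmUpto (n + r) * (n + (r + 1)) := by
      refine Finset.lcm_dvd fun i hi => ?_
      rcases Nat.lt_or_ge (n + r) i with h | h
      · rw [show i = n + (r + 1) by have := (mem_Icc.1 hi).2; omega]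
        exact dvd_mul_left _ _
      · exact (dvd_lcmUpto (mem_Icc.1 hi).1 h).trans (dvd_mul_right _ _)
    calc lcmUpto (n + (r + 1)) ≤ lcmUpto (n + r) * (n + (r + 1)) :=
          Nat.le_of_dvd (Nat.mul_pos (lcmUpto_pos _) (by omega)) h
      _ ≤ lcmUpto n * (n + r) ^ r * (n + (r + 1)) := by gcongr
      _ ≤ lcmUpto n * (n + (r + 1)) ^ r * (n + (r + 1)) := by gcongr; omega
      _ = _ := by ring

lemma lcmUpto_le_step {n : ℕ} (hn : 42 ≤ n) : lcmUpto n ≤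
    lcmUpto (n / 42) * (2 ^ 22 * 3 ^ 15 * 7 ^ 7) ^ (n / 42) * (42 * (n / 42 + 1)) ^ 41 := by
  have hm : n / 42 ≠ 0 := by omega
  have h1 := lcmUpto_add_le (42 * (n / 42)) (n % 42)
  rw [Nat.div_add_mod] at h1
  have h2 : lcmUpto (42 * (n / 42)) ≤ lcmUpto (n / 42) * multi (n / 42) :=
    Nat.le_of_dvd (Nat.mul_pos (lcmUpto_pos _) (Nat.pos_of_ne_zero (multi_ne_zero _)))
      (lcmUpto_mul_dvd _ hm)
  calc lcmUpto n ≤ lcmUpto (42 * (n / 42)) * n ^ (n % 42) := h1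
    _ ≤ lcmUpto (n / 42) * (2 ^ 22 * 3 ^ 15 * 7 ^ 7) ^ (n / 42) * n ^ (n % 42) := by
      gcongr
      exact h2.trans (Nat.mul_le_mul_left _ (multi_le _))
    _ ≤ lcmUpto (n / 42) * (2 ^ 22 * 3 ^ 15 * 7 ^ 7) ^ (n / 42) * n ^ 41 := by
      gcongr <;> omega
    _ ≤ _ := by
      gcongr
      omega

lemma eventually_pow_le_two_pow : ∀ᶠ m : ℕ in atTop, ((42 : ℝ) * (m + 1)) ^ 41 ≤ 2 ^ m := by
  have h := (isLittleO_pow_const_const_pow_of_one_lt (R := ℝ) 41 (one_lt_two)).bound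
    (show (0 : ℝ) < 1 / (2 * 42 ^ 41) by positivity)
  filter_upwards [(tendsto_add_atTop_nat 1).eventually h] with m hm
  rw [Real.norm_of_nonneg (by positivity), Real.norm_of_nonneg (by positivity), pow_succ (2 : ℝ),
    div_mul_eq_mul_div, le_div_iff₀ (by positivity)] at hm
  push_cast at hm
  rw [mul_pow]
  linarith

lemma exists_lcmUpto_le : ∃ A : ℝ, 0 < A ∧ ∀ n : ℕ, (lcmUpto n : ℝ) ≤ A * (16 / 5) ^ n := by
  obtain ⟨m₀, hm₀⟩ := eventually_atTop.1 eventually_pow_le_two_pow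
  refine ⟨∑ i ∈ range (42 * (m₀ + 1)), (lcmUpto i : ℝ),
    sum_pos (fun i _ => by exact_mod_cast lcmUpto_pos i) ⟨0, by simp⟩, fun n => ?_⟩
  set A := ∑ i ∈ range (42 * (m₀ + 1)), (lcmUpto i : ℝ)
  have hA0 : 0 ≤ A := sum_nonneg fun i _ => by positivity
  induction n using Nat.strong_induction_on with
  | _ n ih =>
    rcases lt_or_ge n (42 * (m₀ + 1)) with hn | hn
    · have h1 : (lcmUpto n : ℝ) ≤ A :=
        single_le_sum (f := fun i => (lcmUpto i : ℝ)) (fun i _ => by positivity) (mem_range.2 hn)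
      exact h1.trans (le_mul_of_one_le_right hA0 (one_le_pow₀ (by norm_num)))
    · have h1 : (lcmUpto n : ℝ) ≤ lcmUpto (n / 42) * (2 ^ 22 * 3 ^ 15 * 7 ^ 7) ^ (n / 42) *
          (42 * ((n / 42 : ℕ) + 1)) ^ 41 := by
        exact_mod_cast lcmUpto_le_step (by omega : 42 ≤ n)
      have h2 := hm₀ (n / 42) (by omega)
      have h3 := ih (n / 42) (by omega)
      have h4 : n / 42 + 41 * (n / 42) ≤ n := by omega
      generalize n / 42 = m at h1 h2 h3 h4
      calc (lcmUpto n : ℝ) ≤ A * (16 / 5) ^ m * (2 ^ 22 * 3 ^ 15 * 7 ^ 7) ^ m * 2 ^ m := by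
            refine h1.trans ?_
            gcongr
        _ = A * (16 / 5) ^ m * (2 ^ 22 * 3 ^ 15 * 7 ^ 7 * 2) ^ m := by
            rw [mul_pow _ (2 : ℝ)]; ring
        _ ≤ A * (16 / 5) ^ m * ((16 / 5) ^ 41) ^ m := by
            gcongr
            norm_num
        _ = A * (16 / 5) ^ (m + 41 * m) := by rw [pow_add, pow_mul]; ring
        _ ≤ A * (16 / 5) ^ n := by
            gcongr
            norm_num

lemma natCast_mem_range_intCast (n : ℕ) : (n : ℝ) ∈ (Int.castRingHom ℝ).range := ⟨n, by simp⟩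

lemma lam_mem_range_intCast (n k : ℕ) : lam n k ∈ (Int.castRingHom ℝ).range :=
  mul_mem (natCast_mem_range_intCast _) (natCast_mem_range_intCast _)

lemma a_mem_range_intCast (n : ℕ) : a n ∈ (Int.castRingHom ℝ).range :=
  sum_mem fun k _ => pow_mem (lam_mem_range_intCast n k) 2

lemma choose_add_mul_choose (n k m : ℕ) :
    (n + k).choose k * k.choose m = (n + k).choose (n + m) * (n + m).choose m := by
  have h1 := Nat.choose_mul (n := n + k) (k := n + m) (s := n) (by omega)
  rw [Nat.add_sub_cancel_left, Nat.add_sub_cancel_left, Nat.choose_symm_add,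
    Nat.choose_symm_add] at h1
  exact h1.symm

lemma correction_mem_range_intCast {n k m : ℕ} (hm : m + 1 ≤ k) (hk : k ≤ n) :
    2 * (lcmUpto n : ℝ) ^ 3 *
      (lam n k ^ 2 * ((-1) ^ m / (2 * ((m : ℝ) + 1) ^ 3 * lam n (m + 1)))) ∈
      (Int.castRingHom ℝ).range := by
  obtain ⟨x, hx⟩ := dvd_lcmUpto (by omega : 1 ≤ m + 1) (hm.trans hk)
  obtain ⟨y, hy⟩ := mul_choose_dvd_lcmUpto (by omega : 1 ≤ m + 1) (hm.trans hk)
  obtain ⟨z, hz⟩ := (mul_choose_dvd_lcmUpto (by omega : 1 ≤ m + 1) hm).trans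
    (lcmUpto_dvd_lcmUpto hk)
  have h := choose_add_mul_choose n k (m + 1)
  have h1 : ((n.choose (m + 1) : ℕ) : ℝ) ≠ 0 := by exact_mod_cast (Nat.choose_pos (hm.trans hk)).ne'
  have h2 : (((n + (m + 1)).choose (m + 1) : ℕ) : ℝ) ≠ 0 := by
    exact_mod_cast (Nat.choose_pos (by omega)).ne'
  apply_fun (Nat.cast : ℕ → ℝ) at hx hy hz h
  push_cast at hx hy hz h
  have key : 2 * (lcmUpto n : ℝ) ^ 3 *
      (lam n k ^ 2 * ((-1) ^ m / (2 * ((m : ℝ) + 1) ^ 3 * lam n (m + 1)))) =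
      (-1) ^ m * (lam n k * n.choose k * (n + k).choose (n + (m + 1)) * (x * y * z : ℕ)) := by
    rw [show (lcmUpto n : ℝ) ^ 3 = (((m : ℝ) + 1) * x) * (((m : ℝ) + 1) * n.choose (m + 1) * y) *
      (((m : ℝ) + 1) * k.choose (m + 1) * z) by rw [← hx, ← hy, ← hz]; ring]
    unfold lam
    push_cast
    field_simp
    linear_combination (x : ℝ) * y * z * n.choose k ^ 2 * (n + k).choose k * h
  rw [key]
  have hneg : (-1 : ℝ) ∈ (Int.castRingHom ℝ).range := ⟨-1, by simp⟩
  exact mul_mem (pow_mem hneg m) (mul_mem (mul_mem (mul_mem (lam_mem_range_intCast n k)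
    (natCast_mem_range_intCast _)) (natCast_mem_range_intCast _)) (natCast_mem_range_intCast _))

lemma two_mul_lcmUpto_cube_mul_b_mem (n : ℕ) :
    2 * (lcmUpto n : ℝ) ^ 3 * b n ∈ (Int.castRingHom ℝ).range := by
  rw [b, mul_sum]
  refine sum_mem fun k hk => ?_
  have hk : k ≤ n := by simpa [Nat.lt_succ_iff] using hk
  rw [c, mul_add, mul_add, mul_sum, mul_sum, mul_sum, mul_sum]
  refine add_mem (sum_mem fun m hm => ?_) (sum_mem fun m hm =>
    correction_mem_range_intCast (mem_range.1 hm) hk)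
  obtain ⟨x, hx⟩ := dvd_lcmUpto (by omega : 1 ≤ m + 1) (mem_range.1 hm)
  rw [show 2 * (lcmUpto n : ℝ) ^ 3 * (lam n k ^ 2 * (1 / ((m : ℝ) + 1) ^ 3)) =
    (2 * x ^ 3 : ℕ) * lam n k ^ 2 by rw [hx]; push_cast; field_simp]
  exact mul_mem (natCast_mem_range_intCast _) (pow_mem (lam_mem_range_intCast n k) 2)

lemma a_pos (n : ℕ) : 0 < a n :=
  sum_pos' (fun k _ => sq_nonneg _) ⟨0, by simp, by simp [lam_zero_right]⟩

lemma a_le_a_succ (n : ℕ) : a n ≤ a (n + 1) := by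
  rw [a, a, sum_range_succ _ (n + 1)]
  refine le_add_of_le_of_nonneg (sum_le_sum fun k _ => ?_) (sq_nonneg _)
  have h1 : n.choose k ≤ (n + 1).choose k := Nat.choose_le_choose k (by omega)
  have h2 : (n + k).choose k ≤ (n + 1 + k).choose k := Nat.choose_le_choose k (by omega)
  unfold lam
  gcongr

lemma mul_a_le_a_succ_of_weaker {n : ℕ} {s t : ℝ} (hs : 0 < s) (h : s * a n ≤ a (n + 1))
    (hst : s * t * ((n : ℝ) + 2) ^ 3 ≤ s * midCoeff n - ((n : ℝ) + 1) ^ 3) :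
    t * a (n + 1) ≤ a (n + 2) := by
  have h1 := a_recurrence n
  have h2 : ((n : ℝ) + 1) ^ 3 * (s * a n) ≤ ((n : ℝ) + 1) ^ 3 * a (n + 1) := by gcongr
  have h3 := mul_le_mul_of_nonneg_right hst (a_pos (n + 1)).le
  have h4 : 0 < s * ((n : ℝ) + 2) ^ 3 := by positivity
  refine le_of_mul_le_mul_left ?_ h4
  linear_combination h3 + h2 - s * h1

lemma mul_a_le_a_succ {n : ℕ} (hn : 101 ≤ n) : 33 * a n ≤ a (n + 1) := by
  obtain ⟨m, rfl⟩ := Nat.exists_eq_add_of_le' hn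
  have hm : (0 : ℝ) ≤ m := by positivity
  have h1 : 32 * a (m + 100) ≤ a (m + 101) := by
    refine mul_a_le_a_succ_of_weaker (n := m + 99) one_pos (by simpa using a_le_a_succ _) ?_
    unfold midCoeff
    push_cast
    ring_nf
    nlinarith [pow_nonneg hm 2, pow_nonneg hm 3]
  refine mul_a_le_a_succ_of_weaker (n := m + 100) (by norm_num) h1 ?_
  unfold midCoeff
  push_cast
  ring_nf
  nlinarith [pow_nonneg hm 2, pow_nonneg hm 3]

lemma pow_le_a {n : ℕ} (hn : 101 ≤ n) : (33 : ℝ) ^ n ≤ 33 ^ 101 * a n := by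
  induction n, hn using Nat.le_induction with
  | base =>
    have : 1 ≤ a 101 := by
      simpa [a, lam_zero_right] using single_le_sum (f := fun k => lam 101 k ^ 2)
        (fun k _ => sq_nonneg _) (mem_range.2 (by norm_num : 0 < 101 + 1))
    linarith
  | succ n hn ih =>
    rw [pow_succ]
    linarith [mul_a_le_a_succ hn]

lemma summable_one_div_succ_cube : Summable fun n : ℕ => 1 / ((n : ℝ) + 1) ^ 3 := by
  have := (summable_nat_add_iff 1).2 (Real.summable_one_div_nat_pow.2 (by norm_num : 1 < 3))
  simpa using this

lemma add_one_le_lam {n m : ℕ} (h : m + 1 ≤ n) : (n : ℝ) + 1 ≤ lam n (m + 1) := by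
  have h1 : 1 ≤ n.choose (m + 1) := Nat.choose_pos h
  have h2 : n + 1 ≤ (n + (m + 1)).choose (m + 1) := by
    rw [← Nat.choose_symm_add]
    simpa using Nat.choose_le_choose n (by omega : n + 1 ≤ n + (m + 1))
  have h3 := Nat.mul_le_mul h1 h2
  rw [one_mul] at h3
  unfold lam
  exact_mod_cast h3

lemma abs_c_sub_le {n k : ℕ} (h : k ≤ n) : |c n k - ∑ m ∈ range n, 1 / ((m : ℝ) + 1) ^ 3| ≤
    (∑' m : ℕ, 1 / ((m : ℝ) + 1) ^ 3) / (n + 1) := by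
  rw [c, add_sub_cancel_left]
  calc _ ≤ ∑ m ∈ range k, |(-1) ^ m / (2 * ((m : ℝ) + 1) ^ 3 * lam n (m + 1))| :=
        abs_sum_le_sum_abs _ _
    _ ≤ ∑ m ∈ range k, 1 / ((m : ℝ) + 1) ^ 3 / (n + 1) := by
      refine sum_le_sum fun m hm => ?_
      have h1 := add_one_le_lam ((mem_range.1 hm).trans_le h)
      have h2 := lam_nonneg n (m + 1)
      rw [abs_div, abs_pow, abs_neg, abs_one, one_pow, abs_of_nonneg (by positivity), div_div]
      apply one_div_le_one_div_of_le (by positivity)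
      have h3 : 0 ≤ ((m : ℝ) + 1) ^ 3 * lam n (m + 1) := by positivity
      calc ((m : ℝ) + 1) ^ 3 * (n + 1) ≤ ((m : ℝ) + 1) ^ 3 * lam n (m + 1) := by gcongr
        _ ≤ _ := by linarith
    _ = (∑ m ∈ range k, 1 / ((m : ℝ) + 1) ^ 3) / (n + 1) := by rw [sum_div]
    _ ≤ _ := by
      gcongr
      exact summable_one_div_succ_cube.sum_le_tsum _ fun i _ => by positivity

lemma tendsto_b_div_a :
    Tendsto (fun n => b n / a n) atTop (𝓝 (∑' m : ℕ, 1 / ((m : ℝ) + 1) ^ 3)) := by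
  set Z := ∑' m : ℕ, 1 / ((m : ℝ) + 1) ^ 3
  have h1 := summable_one_div_succ_cube.hasSum.tendsto_sum_nat
  have h2 : Tendsto (fun n : ℕ => Z / ((n : ℝ) + 1)) atTop (𝓝 0) :=
    tendsto_const_nhds.div_atTop (tendsto_natCast_atTop_atTop.atTop_add tendsto_const_nhds)
  have h3 : Tendsto (fun n => b n / a n - ∑ m ∈ range n, 1 / ((m : ℝ) + 1) ^ 3) atTop (𝓝 0) := by
    refine squeeze_zero_norm (fun n => ?_) h2
    rw [Real.norm_eq_abs, div_sub' (a_pos n).ne', abs_div, abs_of_pos (a_pos n),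
      div_le_iff₀ (a_pos n), b, a, sum_mul, ← sum_sub_distrib, mul_sum]
    refine (abs_sum_le_sum_abs _ _).trans (sum_le_sum fun k hk => ?_)
    rw [← mul_sub, abs_mul, abs_of_nonneg (sq_nonneg _), mul_comm]
    exact mul_le_mul_of_nonneg_right (abs_c_sub_le (Nat.lt_succ_iff.1 (mem_range.1 hk)))
      (sq_nonneg _)
  simpa only [sub_add_cancel, zero_add] using h3.add h1

lemma b_div_a_succ_sub (n : ℕ) :
    b (n + 1) / a (n + 1) - b n / a n = 6 / (((n : ℝ) + 1) ^ 3 * (a n * a (n + 1))) := by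
  have h := casoratian n
  have h1 := (a_pos n).ne'
  have h2 := (a_pos (n + 1)).ne'
  rw [eq_div_iff (by positivity)] at h
  field_simp
  linear_combination h

lemma b_div_a_lt (n : ℕ) : b n / a n < ∑' m : ℕ, 1 / ((m : ℝ) + 1) ^ 3 := by
  have hs : StrictMono fun n => b n / a n := strictMono_nat_of_lt_succ fun n => by
    have := a_pos n
    have := a_pos (n + 1)
    rw [← sub_pos, b_div_a_succ_sub]
    positivity
  exact (hs n.lt_succ_self).trans_le (hs.monotone.ge_of_tendsto tendsto_b_div_a (n + 1))

lemma tendsto_a_atTop : Tendsto a atTop atTop := by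
  have h : Tendsto (fun n : ℕ => (33 : ℝ) ^ n / 33 ^ 101) atTop atTop :=
    (tendsto_pow_atTop_atTop_of_one_lt (by norm_num)).atTop_div_const (by positivity)
  refine tendsto_atTop_mono' _ ?_ h
  filter_upwards [eventually_ge_atTop 101] with n hn
  rw [div_le_iff₀' (by positivity)]
  exact pow_le_a hn

lemma le_b_div_a_add {n : ℕ} (hn : 101 ≤ n) :
    ∑' m : ℕ, 1 / ((m : ℝ) + 1) ^ 3 ≤ b n / a n + 8 / a n ^ 2 := by
  have step : ∀ m ≥ 101, b (m + 1) / a (m + 1) + 8 / a (m + 1) ^ 2 ≤ b m / a m + 8 / a m ^ 2 := by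
    intro m hm
    have h1 := b_div_a_succ_sub m
    have ha := a_pos m
    have ha' := a_pos (m + 1)
    have h33 := mul_a_le_a_succ hm
    have h2 : 6 / (((m : ℝ) + 1) ^ 3 * (a m * a (m + 1))) ≤ 6 / a m ^ 2 := by
      apply div_le_div_of_nonneg_left (by norm_num) (by positivity)
      have : (1 : ℝ) ≤ ((m : ℝ) + 1) ^ 3 := one_le_pow₀ (by linarith [(m.cast_nonneg : (0 : ℝ) ≤ m)])
      calc a m ^ 2 = 1 * (a m * a m) := by ring
        _ ≤ _ := by gcongr; linarith
    have h3 : 8 / a (m + 1) ^ 2 ≤ 2 / a m ^ 2 := by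
      rw [div_le_div_iff₀ (by positivity) (by positivity)]
      nlinarith
    have h4 : 8 / a m ^ 2 = 6 / a m ^ 2 + 2 / a m ^ 2 := by ring
    linarith
  have hlim : Tendsto (fun n => b n / a n + 8 / a n ^ 2) atTop
      (𝓝 (∑' m : ℕ, 1 / ((m : ℝ) + 1) ^ 3)) := by
    simpa using tendsto_b_div_a.add (tendsto_const_nhds (x := (8 : ℝ)) |>.div_atTop
      ((tendsto_pow_atTop two_ne_zero).comp tendsto_a_atTop))
  refine le_of_tendsto hlim ?_
  filter_upwards [eventually_ge_atTop n] with m hm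
  induction m, hm using Nat.le_induction with
  | base => exact le_rfl
  | succ m hm ih => exact (step m (hn.trans hm)).trans ih

theorem irrational_tsum_one_div_succ_cube : Irrational (∑' m : ℕ, 1 / ((m : ℝ) + 1) ^ 3) := by
  rintro ⟨r, hr⟩
  obtain ⟨A, hA, hd⟩ := exists_lcmUpto_le
  set Z := ∑' m : ℕ, 1 / ((m : ℝ) + 1) ^ 3
  have hq : (0 : ℝ) < r.den := by exact_mod_cast r.den_pos
  have hqZ : (r.den : ℝ) * Z = r.num := by
    rw [← hr]
    exact_mod_cast r.den_mul_eq_num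
  have lower : ∀ n, 1 ≤ 2 * (lcmUpto n : ℝ) ^ 3 * r.den * (a n * Z - b n) := by
    intro n
    have hpos : 0 < 2 * (lcmUpto n : ℝ) ^ 3 * r.den * (a n * Z - b n) := by
      have h1 : 0 < (lcmUpto n : ℝ) := by exact_mod_cast lcmUpto_pos n
      have h2 := (div_lt_iff₀' (a_pos n)).1 (b_div_a_lt n)
      have h3 : 0 < a n * Z - b n := by linarith
      positivity
    obtain ⟨z, hz⟩ : 2 * (lcmUpto n : ℝ) ^ 3 * r.den * (a n * Z - b n) ∈
        (Int.castRingHom ℝ).range := by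
      rw [show 2 * (lcmUpto n : ℝ) ^ 3 * r.den * (a n * Z - b n) =
        (2 * lcmUpto n ^ 3 : ℕ) * a n * r.num - r.den * (2 * (lcmUpto n : ℝ) ^ 3 * b n) by
        rw [← hqZ]; push_cast; ring]
      exact sub_mem (mul_mem (mul_mem (natCast_mem_range_intCast _) (a_mem_range_intCast n))
        ⟨r.num, by simp⟩) (mul_mem (natCast_mem_range_intCast _)
          (two_mul_lcmUpto_cube_mul_b_mem n))
    rw [← hz] at hpos ⊢
    simp only [eq_intCast] at hpos ⊢
    exact_mod_cast hpos
  have upper : ∀ n ≥ 101, 2 * (lcmUpto n : ℝ) ^ 3 * r.den * (a n * Z - b n) ≤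
      16 * A ^ 3 * r.den * 33 ^ 101 * (4096 / 4125) ^ n := by
    intro n hn
    have ha := a_pos n
    have h1 : a n * Z - b n ≤ 8 / a n := by
      have h := mul_le_mul_of_nonneg_left (le_b_div_a_add hn) ha.le
      rw [show a n * (b n / a n + 8 / a n ^ 2) = b n + 8 / a n by field_simp] at h
      linarith
    have h2 : 8 / a n ≤ 8 * 33 ^ 101 / 33 ^ n := by
      rw [div_le_div_iff₀ ha (by positivity)]
      linarith [pow_le_a hn]
    calc 2 * (lcmUpto n : ℝ) ^ 3 * r.den * (a n * Z - b n)
        ≤ 2 * (A * (16 / 5) ^ n) ^ 3 * r.den * (8 * 33 ^ 101 / 33 ^ n) := by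
          have h3 := h1.trans h2
          have h4 := hd n
          calc _ ≤ 2 * (lcmUpto n : ℝ) ^ 3 * r.den * (8 * 33 ^ 101 / 33 ^ n) := by gcongr
            _ ≤ _ := by gcongr
      _ = 16 * A ^ 3 * r.den * 33 ^ 101 * (((16 / 5) ^ 3) ^ n / 33 ^ n) := by
          rw [mul_pow, ← pow_mul, ← pow_mul, mul_comm n 3]; ring
      _ = _ := by rw [← div_pow]; norm_num
  have hlim : Tendsto (fun n : ℕ => 16 * A ^ 3 * r.den * 33 ^ 101 * (4096 / 4125 : ℝ) ^ n)
      atTop (𝓝 0) := by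
    simpa using (tendsto_pow_atTop_nhds_zero_of_lt_one (by norm_num : (0 : ℝ) ≤ 4096 / 4125)
      (by norm_num)).const_mul (16 * A ^ 3 * r.den * 33 ^ 101)
  obtain ⟨n, hn, hn'⟩ := ((hlim.eventually_lt_const one_pos).and (eventually_ge_atTop 101)).exists
  linarith [lower n, upper n hn']

end Apery

/-- The value ζ(3) of the Riemann zeta function at 3, i.e. the sum Σ_{n=1}^∞ 1/n³,
is an irrational real number. -/
theorem zeta_three_irrational :
    ∃ x : ℝ, riemannZeta 3 = (x : ℂ) ∧ x = ∑' n : ℕ, 1 / ((n : ℝ) + 1) ^ 3 ∧ Irrational x := by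
  refine ⟨_, ?_, rfl, Apery.irrational_tsum_one_div_succ_cube⟩
  rw [zeta_eq_tsum_one_div_nat_add_one_cpow (by norm_num)]
  push_cast
  refine tsum_congr fun n => ?_
  norm_cast
end

section
/- (Wilf's infinite product formula) The infinite product ∏_{k=1}^∞ { e^{−1/k} ( 1 + 1/k + 1/(2k²) ) } converges and equals (e^{π/2} + e^{−π/2}) / (π · e^{γ}). -/
open Filter Topology

/-- The quadratic Taylor polynomial of `exp`, multiplied by `exp (-x)`, is within `x ^ 2` of `1`
on `[0, 1]`. -/
lemma abs_exp_neg_mul_quadratic_sub_one_le {x : ℝ} (hx : 0 ≤ x) (hx' : x ≤ 1) :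
    |Real.exp (-x) * (1 + x + x ^ 2 / 2) - 1| ≤ x ^ 2 := by
  have hpos : 0 < 1 + x + x ^ 2 / 2 := by positivity
  have hupper : Real.exp (-x) * (1 + x + x ^ 2 / 2) ≤ 1 := by
    calc Real.exp (-x) * (1 + x + x ^ 2 / 2) ≤ Real.exp (-x) * Real.exp x := by
          gcongr
          exact Real.quadratic_le_exp_of_nonneg hx
      _ = 1 := by rw [← Real.exp_add, neg_add_cancel, Real.exp_zero]
  have hlower : (1 - x) * (1 + x + x ^ 2 / 2) ≤ Real.exp (-x) * (1 + x + x ^ 2 / 2) := by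
    gcongr
    exact Real.one_sub_le_exp_neg x
  rw [abs_le]
  constructor
  · nlinarith [mul_nonneg (sq_nonneg x) (sub_nonneg.2 hx')]
  · nlinarith [sq_nonneg x]

/-- The product of the Gamma sequences at `(1 ± i) / 2`, inverted. -/
lemma inv_GammaSeq_mul_GammaSeq_eq {n : ℕ} (hn : n ≠ 0) :
    (Complex.GammaSeq ((1 + Complex.I) / 2) n *
        Complex.GammaSeq (1 - (1 + Complex.I) / 2) n)⁻¹ =
      (((∏ k ∈ Finset.range n, (1 + 1 / ((k : ℝ) + 1) + 1 / (2 * ((k : ℝ) + 1) ^ 2))) /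
        (2 * n) : ℝ) : ℂ) := by
  have hn' : (n : ℂ) ≠ 0 := Nat.cast_ne_zero.2 hn
  have hpow : (n : ℂ) ^ ((1 + Complex.I) / 2) * (n : ℂ) ^ (1 - (1 + Complex.I) / 2) = n := by
    rw [← Complex.cpow_add _ _ hn', add_sub_cancel, Complex.cpow_one]
  have hfactor (j : ℕ) : ((1 + Complex.I) / 2 + j) * (1 - (1 + Complex.I) / 2 + j) =
      (j : ℂ) ^ 2 + j + 1 / 2 := by
    linear_combination (-1 / 4 : ℂ) * Complex.I_sq
  have hfact : ((n.factorial : ℕ) : ℂ) ^ 2 = ∏ k ∈ Finset.range n, ((k : ℂ) + 1) ^ 2 := by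
    rw [← Finset.prod_range_add_one_eq_factorial, Finset.prod_pow]
    push_cast
    rfl
  have hprod : ∏ j ∈ Finset.range (n + 1), ((j : ℂ) ^ 2 + j + 1 / 2) =
      (n.factorial : ℂ) ^ 2 / 2 *
        ∏ k ∈ Finset.range n, (1 + 1 / ((k : ℂ) + 1) + 1 / (2 * ((k : ℂ) + 1) ^ 2)) := by
    rw [hfact, Finset.prod_range_succ', div_mul_eq_mul_div, ← Finset.prod_mul_distrib]
    simp only [Nat.cast_zero, ne_eq, OfNat.ofNat_ne_zero, not_false_eq_true, zero_pow, zero_add,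
      mul_one_div]
    congr 1
    refine Finset.prod_congr rfl fun k _ ↦ ?_
    have hk : (k : ℂ) + 1 ≠ 0 := Nat.cast_add_one_ne_zero k
    push_cast
    field_simp
  have hfac0 : (n.factorial : ℂ) ≠ 0 := Nat.cast_ne_zero.2 n.factorial_ne_zero
  rw [Complex.GammaSeq, Complex.GammaSeq, div_mul_div_comm, ← Finset.prod_mul_distrib,
    Finset.prod_congr rfl fun j _ ↦ hfactor j, hprod, mul_mul_mul_comm, hpow, inv_div]
  push_cast
  field_simp

lemma tendsto_prod_quadratic_div :
    Tendsto (fun n : ℕ ↦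
      (∏ k ∈ Finset.range n, (1 + 1 / ((k : ℝ) + 1) + 1 / (2 * ((k : ℝ) + 1) ^ 2))) / (2 * (n : ℝ)))
      atTop (𝓝 (Real.cosh (Real.pi / 2) / Real.pi)) := by
  have hsin : Complex.sin (Real.pi * ((1 + Complex.I) / 2)) =
      ((Real.cosh (Real.pi / 2) : ℝ) : ℂ) := by
    rw [show (Real.pi : ℂ) * ((1 + Complex.I) / 2) =
      (Real.pi / 2 : ℂ) * Complex.I + Real.pi / 2 by ring, Complex.sin_add_pi_div_two,
      Complex.cos_mul_I]
    push_cast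
    rfl
  have hlim := (Complex.GammaSeq_tendsto_Gamma ((1 + Complex.I) / 2)).mul
    (Complex.GammaSeq_tendsto_Gamma (1 - (1 + Complex.I) / 2))
  rw [Complex.Gamma_mul_Gamma_one_sub, hsin, ← Complex.ofReal_div] at hlim
  have hne : ((Real.pi / Real.cosh (Real.pi / 2) : ℝ) : ℂ) ≠ 0 :=
    Complex.ofReal_ne_zero.2 (div_pos Real.pi_pos (Real.cosh_pos _)).ne'
  have hinv := hlim.inv₀ hne
  rw [← Complex.ofReal_inv, inv_div] at hinv
  rw [← tendsto_ofReal_iff]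
  refine hinv.congr' ?_
  filter_upwards [eventually_ne_atTop 0] with n hn
  exact inv_GammaSeq_mul_GammaSeq_eq hn

lemma tendsto_mul_prod_exp_neg :
    Tendsto (fun n : ℕ ↦ (n : ℝ) * ∏ k ∈ Finset.range n, Real.exp (-(1 / ((k : ℝ) + 1))))
      atTop (𝓝 (Real.exp (-Real.eulerMascheroniConstant))) := by
  refine ((Real.continuous_exp.tendsto _).comp Real.tendsto_harmonic_sub_log.neg).congr' ?_
  filter_upwards [eventually_gt_atTop 0] with n hn
  have hn' : (0 : ℝ) < n := Nat.cast_pos.2 hn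
  rw [Function.comp_apply, neg_sub, sub_eq_add_neg, Real.exp_add, Real.exp_log hn',
    ← Real.exp_sum, Finset.sum_neg_distrib, harmonic]
  push_cast
  simp only [one_div]

/-- (Wilf) The infinite product ∏_{k=1}^∞ e^{−1/k}(1 + 1/k + 1/(2k²)) converges and
equals (e^{π/2} + e^{−π/2}) / (π · e^{γ}). -/
theorem wilf_product :
    HasProd
      (fun k : ℕ => Real.exp (-(1 / ((k : ℝ) + 1))) *
        (1 + 1 / ((k : ℝ) + 1) + 1 / (2 * ((k : ℝ) + 1) ^ 2)))
      ((Real.exp (Real.pi / 2) + Real.exp (-(Real.pi / 2))) /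
        (Real.pi * Real.exp Real.eulerMascheroniConstant)) := by
  have hmult : Multipliable (fun k : ℕ => Real.exp (-(1 / ((k : ℝ) + 1))) *
      (1 + 1 / ((k : ℝ) + 1) + 1 / (2 * ((k : ℝ) + 1) ^ 2))) := by
    have hsq : Summable fun k : ℕ ↦ (1 / ((k : ℝ) + 1)) ^ 2 := by
      simpa using (summable_nat_add_iff 1).2 (Real.summable_one_div_nat_pow.2 one_lt_two)
    have hsum : Summable fun k : ℕ ↦ Real.exp (-(1 / ((k : ℝ) + 1))) *
        (1 + 1 / ((k : ℝ) + 1) + 1 / (2 * ((k : ℝ) + 1) ^ 2)) - 1 := by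
      refine hsq.of_norm_bounded fun k ↦ ?_
      have hk : 1 / ((k : ℝ) + 1) ≤ 1 := by
        rw [div_le_one (by positivity)]
        exact le_add_of_nonneg_left k.cast_nonneg
      have hquad : 1 / (2 * ((k : ℝ) + 1) ^ 2) = (1 / ((k : ℝ) + 1)) ^ 2 / 2 := by
        field_simp
      rw [Real.norm_eq_abs, hquad]
      exact abs_exp_neg_mul_quadratic_sub_one_le (by positivity) hk
    simpa using Real.multipliable_one_add_of_summable hsum
  rw [hmult.hasProd_iff_tendsto_nat]
  have hlim := (tendsto_mul_prod_exp_neg.mul tendsto_prod_quadratic_div).const_mul 2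
  have hvalue : 2 * (Real.exp (-Real.eulerMascheroniConstant) *
      (Real.cosh (Real.pi / 2) / Real.pi)) =
      (Real.exp (Real.pi / 2) + Real.exp (-(Real.pi / 2))) /
        (Real.pi * Real.exp Real.eulerMascheroniConstant) := by
    rw [Real.cosh_eq, Real.exp_neg Real.eulerMascheroniConstant]
    field_simp
  rw [hvalue] at hlim
  refine hlim.congr' ?_
  filter_upwards [eventually_ne_atTop 0] with n hn
  have hn' : (n : ℝ) ≠ 0 := Nat.cast_ne_zero.2 hn
  rw [Finset.prod_mul_distrib]
  field_simp
end

section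
/- (Choi–Lee–Srivastava) For every complex number α with α ≠ i/2 and α ≠ −i/2, the infinite product ∏_{k=1}^∞ { e^{−1/k} ( 1 + 1/k + (α² + 1/4)/k² ) } converges and equals 2(e^{απ} + e^{−απ}) / ((4α² + 1) π · e^{γ}). -/
open Complex

open Filter Topology in
/-- `(n + 1) e^{-H_n} → e^{-γ}`. -/
lemma tendsto_prod_exp_neg_mul_succ :
    Tendsto (fun n : ℕ =>
        (∏ k ∈ Finset.range n, Complex.exp (-(1 / ((k : ℂ) + 1)))) * ((n : ℂ) + 1))
      atTop (𝓝 (Complex.exp (-(Real.eulerMascheroniConstant : ℂ)))) := by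
  have h := ((Complex.continuous_exp.comp
    (Complex.continuous_ofReal.comp continuous_neg)).tendsto _).comp
    Real.tendsto_eulerMascheroniSeq
  simp only [Function.comp_apply, Complex.ofReal_neg] at h
  refine h.congr fun n => ?_
  have hlog : Complex.exp ((Real.log ((n : ℝ) + 1) : ℝ) : ℂ) = (n : ℂ) + 1 := by
    rw [← Complex.ofReal_exp, Real.exp_log (by positivity)]
    push_cast
    rfl
  simp only [Function.comp_apply, Real.eulerMascheroniSeq, harmonic]
  rw [← Complex.exp_sum, ← hlog, ← Complex.exp_add]
  push_cast
  simp only [one_div, Finset.sum_neg_distrib]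
  congr 1
  ring

/-- The quadratic factors with root parameters `s` and `1 - s` telescope to the factors of the
Euler sine product. -/
lemma prod_one_add_one_div_add_div_sq {s : ℂ} (hs : 1 - s ≠ 0) (n : ℕ) :
    ∏ k ∈ Finset.range n, (1 + 1 / ((k : ℂ) + 1) + s * (1 - s) / ((k : ℂ) + 1) ^ 2) =
      (∏ k ∈ Finset.range n, (1 - s ^ 2 / ((k : ℂ) + 1) ^ 2)) * (((n : ℂ) + 1 - s) / (1 - s)) := by
  induction n with
  | zero => simp [hs]
  | succ n ih =>
    have hn : (n : ℂ) + 1 ≠ 0 := Nat.cast_add_one_ne_zero n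
    rw [Finset.prod_range_succ, Finset.prod_range_succ, ih, mul_assoc, mul_assoc]
    congr 1
    push_cast
    field_simp
    ring

lemma norm_exp_neg_mul_sub_one_le (c : ℂ) {x : ℂ} (hx : ‖x‖ ≤ 1) :
    ‖Complex.exp (-x) * (1 + x + c * x ^ 2) - 1‖ ≤ (3 + 3 * ‖c‖) * ‖x‖ ^ 2 := by
  have hexp : ‖Complex.exp (-x) - 1 - -x‖ ≤ ‖x‖ ^ 2 := by
    simpa using Complex.norm_exp_sub_one_sub_id_le (x := -x) (by simpa using hx)
  have hquad : ‖1 + x + c * x ^ 2‖ ≤ 2 + ‖c‖ := by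
    calc ‖1 + x + c * x ^ 2‖ ≤ ‖(1 : ℂ)‖ + ‖x‖ + ‖c * x ^ 2‖ := norm_add₃_le
      _ ≤ 1 + 1 + ‖c‖ * 1 := by
        rw [norm_one, norm_mul, norm_pow]
        gcongr
        exact pow_le_one₀ (norm_nonneg x) hx
      _ = 2 + ‖c‖ := by ring
  have hrem : ‖-1 + c + -(c * x)‖ ≤ 1 + 2 * ‖c‖ := by
    calc ‖-1 + c + -(c * x)‖ ≤ ‖(-1 : ℂ)‖ + ‖c‖ + ‖-(c * x)‖ := norm_add₃_le
      _ ≤ 1 + ‖c‖ + ‖c‖ * 1 := by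
        rw [norm_neg, norm_one, norm_neg, norm_mul]
        gcongr
      _ = 1 + 2 * ‖c‖ := by ring
  calc ‖Complex.exp (-x) * (1 + x + c * x ^ 2) - 1‖
      = ‖(Complex.exp (-x) - 1 - -x) * (1 + x + c * x ^ 2) + x ^ 2 * (-1 + c + -(c * x))‖ := by
        congr 1
        ring
    _ ≤ ‖x‖ ^ 2 * (2 + ‖c‖) + ‖x‖ ^ 2 * (1 + 2 * ‖c‖) := by
        refine (norm_add_le _ _).trans ?_
        rw [norm_mul, norm_mul, norm_pow]
        gcongr
    _ = (3 + 3 * ‖c‖) * ‖x‖ ^ 2 := by ring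

lemma multipliable_exp_neg_mul_one_add (c : ℂ) :
    Multipliable (fun k : ℕ => Complex.exp (-(1 / ((k : ℂ) + 1))) *
      (1 + 1 / ((k : ℂ) + 1) + c / ((k : ℂ) + 1) ^ 2)) := by
  have hsum : Summable (fun k : ℕ => (3 + 3 * ‖c‖) * (1 / ((k : ℝ) + 1) ^ 2)) := by
    refine Summable.mul_left _ ?_
    simpa using (summable_nat_add_iff 1).2 (Real.summable_one_div_nat_pow.2 one_lt_two)
  have hnorm (k : ℕ) : ‖1 / ((k : ℂ) + 1)‖ = 1 / ((k : ℝ) + 1) := by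
    rw [norm_div, norm_one]
    norm_cast
  have h := multipliable_one_add_of_summable (f := fun k : ℕ =>
    Complex.exp (-(1 / ((k : ℂ) + 1))) *
      (1 + 1 / ((k : ℂ) + 1) + c / ((k : ℂ) + 1) ^ 2) - 1) <| by
    refine hsum.of_nonneg_of_le (fun k => norm_nonneg _) fun k => ?_
    have hle : ‖1 / ((k : ℂ) + 1)‖ ≤ 1 := by
      rw [hnorm, div_le_one (by positivity)]
      linarith [k.cast_nonneg (α := ℝ)]
    have := norm_exp_neg_mul_sub_one_le c hle
    rwa [hnorm, div_pow, div_pow, one_pow, one_pow, mul_one_div] at this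
  simpa only [add_sub_cancel] using h

open Filter Topology in
lemma hasProd_exp_neg_mul_one_add {s : ℂ} (hs₀ : s ≠ 0) (hs₁ : 1 - s ≠ 0) :
    HasProd (fun k : ℕ => Complex.exp (-(1 / ((k : ℂ) + 1))) *
        (1 + 1 / ((k : ℂ) + 1) + s * (1 - s) / ((k : ℂ) + 1) ^ 2))
      (Complex.exp (-(Real.eulerMascheroniConstant : ℂ)) *
        (Complex.sin (Real.pi * s) / (Real.pi * s * (1 - s)))) := by
  have hπ : (Real.pi : ℂ) ≠ 0 := Complex.ofReal_ne_zero.2 Real.pi_ne_zero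
  have hratio : Tendsto (fun n : ℕ => 1 - s * (1 / ((n : ℂ) + 1))) atTop (𝓝 1) := by
    simpa using (tendsto_one_div_add_atTop_nhds_zero_nat (𝕜 := ℂ)).const_mul s |>.const_sub 1
  have hlim := (tendsto_prod_exp_neg_mul_succ.mul hratio).mul
    ((Complex.tendsto_euler_sin_prod s).div_const (Real.pi * s * (1 - s)))
  rw [mul_one] at hlim
  have hprod := (multipliable_exp_neg_mul_one_add (s * (1 - s))).hasProd
  convert hprod using 1
  refine tendsto_nhds_unique hlim (hprod.tendsto_prod_nat.congr fun n => ?_)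
  have hn : (n : ℂ) + 1 ≠ 0 := Nat.cast_add_one_ne_zero n
  rw [Finset.prod_mul_distrib, prod_one_add_one_div_add_div_sq hs₁]
  field_simp

/-- (Choi–Lee–Srivastava) For every complex α with α ≠ ±i/2, the infinite product
∏_{k=1}^∞ e^{−1/k}(1 + 1/k + (α² + 1/4)/k²) converges and equals
2(e^{απ} + e^{−απ}) / ((4α² + 1) π e^{γ}). -/
theorem choi_lee_srivastava_product_one (α : ℂ) (h₁ : α ≠ I / 2) (h₂ : α ≠ -(I / 2)) :
    HasProd
      (fun k : ℕ => Complex.exp (-(1 / ((k : ℂ) + 1))) *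
        (1 + 1 / ((k : ℂ) + 1) + (α ^ 2 + 1 / 4) / ((k : ℂ) + 1) ^ 2))
      (2 * (Complex.exp (α * Real.pi) + Complex.exp (-(α * Real.pi))) /
        ((4 * α ^ 2 + 1) * Real.pi * Complex.exp (Real.eulerMascheroniConstant : ℂ))) := by
  have hs₀ : 1 / 2 + α * I ≠ 0 := fun h => h₁ (by linear_combination (-I) * h + α * I_sq)
  have hs₁ : 1 - (1 / 2 + α * I) ≠ 0 := fun h => h₂ (by linear_combination I * h + α * I_sq)
  have hmul : (1 / 2 + α * I) * (1 - (1 / 2 + α * I)) = α ^ 2 + 1 / 4 := by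
    linear_combination (-α ^ 2) * I_sq
  have hsin : Complex.sin (Real.pi * (1 / 2 + α * I)) =
      (Complex.exp (α * Real.pi) + Complex.exp (-(α * Real.pi))) / 2 := by
    rw [show (Real.pi : ℂ) * (1 / 2 + α * I) = α * Real.pi * I + Real.pi / 2 by ring,
      Complex.sin_add_pi_div_two, Complex.cos_mul_I, Complex.cosh]
  have h := hasProd_exp_neg_mul_one_add hs₀ hs₁
  have hne : 4 * α ^ 2 + 1 ≠ 0 := fun h0 =>
    mul_ne_zero hs₀ hs₁ (by linear_combination hmul + h0 / 4)
  rw [mul_assoc (Real.pi : ℂ), hmul, hsin, Complex.exp_neg] at h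
  convert h using 1
  rw [show α ^ 2 + 1 / 4 = (4 * α ^ 2 + 1) / 4 by ring]
  have hπ : (Real.pi : ℂ) ≠ 0 := Complex.ofReal_ne_zero.2 Real.pi_ne_zero
  field_simp
  ring
end

section
/- (Choi–Lee–Srivastava) For every complex number β with β ≠ 0, β ≠ i and β ≠ −i, the infinite product ∏_{k=1}^∞ { e^{−2/k} ( 1 + 2/k + (β² + 1)/k² ) } converges and equals (e^{βπ} − e^{−βπ}) / (2β(β² + 1) π · e^{2γ}). -/
open Complex Filter Topology

lemma norm_exp_neg_two_mul_quadratic_sub_one_le (c u : ℂ) (hu : ‖u‖ ≤ 1 / 2) :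
    ‖exp (-(2 * u)) * (1 + 2 * u + c * u ^ 2) - 1‖ ≤ (16 + 7 * ‖c‖) * ‖u‖ ^ 2 := by
  have hu0 := norm_nonneg u
  have hc0 := norm_nonneg c
  have h2u : ‖-(2 * u)‖ = 2 * ‖u‖ := by simp
  have hexp : ‖exp (-(2 * u)) - 1 - -(2 * u)‖ ≤ 4 * ‖u‖ ^ 2 := by
    refine (norm_exp_sub_one_sub_id_le (by rw [h2u]; linarith)).trans_eq ?_
    rw [h2u]
    ring
  have hquad : ‖1 + 2 * u + c * u ^ 2‖ ≤ 3 + ‖c‖ := by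
    calc ‖1 + 2 * u + c * u ^ 2‖ ≤ ‖(1 : ℂ)‖ + ‖2 * u‖ + ‖c * u ^ 2‖ := norm_add₃_le
      _ = 1 + 2 * ‖u‖ + ‖c‖ * ‖u‖ ^ 2 := by simp
      _ ≤ 3 + ‖c‖ := by
        nlinarith [mul_le_of_le_one_right hc0 (pow_le_one₀ (n := 2) hu0 (by linarith))]
  have hrest : ‖c - 4 - 2 * c * u‖ ≤ 4 + 3 * ‖c‖ := by
    calc ‖c - 4 - 2 * c * u‖ ≤ ‖c‖ + ‖(4 : ℂ)‖ + ‖2 * c * u‖ :=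
          (norm_sub_le _ _).trans (by gcongr; exact norm_sub_le _ _)
      _ = ‖c‖ + 4 + 2 * ‖c‖ * ‖u‖ := by simp
      _ ≤ 4 + 3 * ‖c‖ := by nlinarith
  calc ‖exp (-(2 * u)) * (1 + 2 * u + c * u ^ 2) - 1‖
      = ‖(exp (-(2 * u)) - 1 - -(2 * u)) * (1 + 2 * u + c * u ^ 2)
          + (c - 4 - 2 * c * u) * u ^ 2‖ := by ring_nf
    _ ≤ ‖exp (-(2 * u)) - 1 - -(2 * u)‖ * ‖1 + 2 * u + c * u ^ 2‖
          + ‖c - 4 - 2 * c * u‖ * ‖u‖ ^ 2 := by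
        refine (norm_add_le _ _).trans_eq ?_
        simp only [norm_mul, norm_pow]
    _ ≤ 4 * ‖u‖ ^ 2 * (3 + ‖c‖) + (4 + 3 * ‖c‖) * ‖u‖ ^ 2 := by gcongr
    _ = (16 + 7 * ‖c‖) * ‖u‖ ^ 2 := by ring

lemma multipliable_exp_neg_two_div_mul_quadratic (c : ℂ) :
    Multipliable fun k : ℕ => exp (-(2 / ((k : ℂ) + 1))) *
      (1 + 2 / ((k : ℂ) + 1) + c / ((k : ℂ) + 1) ^ 2) := by
  have hsum : Summable fun k : ℕ => (16 + 7 * ‖c‖) * (1 / ((k : ℝ) + 1) ^ 2) := by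
    have h := (summable_nat_add_iff 1).2 (Real.summable_one_div_nat_pow.2 one_lt_two)
    push_cast at h
    exact h.mul_left _
  have hsub : Summable fun k : ℕ => ‖exp (-(2 / ((k : ℂ) + 1))) *
      (1 + 2 / ((k : ℂ) + 1) + c / ((k : ℂ) + 1) ^ 2) - 1‖ := by
    refine hsum.of_norm_bounded_eventually_nat ?_
    filter_upwards [eventually_ge_atTop 1] with k hk
    have hk' : (1 : ℝ) ≤ k := by exact_mod_cast hk
    have hnorm : ‖((k : ℂ) + 1)⁻¹‖ = ((k : ℝ) + 1)⁻¹ := by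
      rw [norm_inv]
      exact_mod_cast congrArg Inv.inv (Complex.norm_natCast (k + 1))
    have h := norm_exp_neg_two_mul_quadratic_sub_one_le c ((k : ℂ) + 1)⁻¹ (by
      rw [hnorm, one_div]
      gcongr
      linarith)
    rw [hnorm] at h
    simpa [div_eq_mul_inv] using h
  simpa using multipliable_one_add_of_summable hsub

lemma prod_range_exp_neg_two_div_mul_quadratic (β : ℂ) (hβ : β ^ 2 + 1 ≠ 0) (n : ℕ) :
    ∏ k ∈ Finset.range n, exp (-(2 / ((k : ℂ) + 1))) *
        (1 + 2 / ((k : ℂ) + 1) + (β ^ 2 + 1) / ((k : ℂ) + 1) ^ 2) =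
      exp (-(2 * (Real.eulerMascheroniSeq n : ℂ))) *
        ((∏ j ∈ Finset.range (n + 1), (1 + β ^ 2 / ((j : ℂ) + 1) ^ 2)) / (β ^ 2 + 1)) := by
  have hexp (m : ℕ) : exp (-(2 * (Real.eulerMascheroniSeq m : ℂ))) =
      exp (-(2 * (harmonic m : ℂ))) * ((m : ℂ) + 1) ^ 2 := by
    have hlog : exp (Real.log ((m : ℝ) + 1) : ℂ) = (m : ℂ) + 1 := by
      rw [← ofReal_exp, Real.exp_log (by positivity)]
      push_cast
      rfl
    rw [← hlog, ← exp_nat_mul, ← exp_add, Real.eulerMascheroniSeq]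
    push_cast
    ring_nf
  induction n with
  | zero => simp [add_comm (1 : ℂ), hβ, Real.eulerMascheroniSeq_zero]
  | succ n ih =>
    have hn : (n : ℂ) + 1 ≠ 0 := by exact_mod_cast n.succ_ne_zero
    have hn' : (n : ℂ) + 1 + 1 ≠ 0 := by exact_mod_cast (n + 1).succ_ne_zero
    rw [Finset.prod_range_succ, ih, Finset.prod_range_succ _ (n + 1), hexp, hexp, harmonic_succ]
    have hsplit : exp (-(2 * ((harmonic n + ((n + 1 : ℕ) : ℚ)⁻¹ : ℚ) : ℂ))) =
        exp (-(2 * (harmonic n : ℂ))) * exp (-(2 / ((n : ℂ) + 1))) := by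
      rw [← exp_add]
      push_cast
      ring_nf
    rw [hsplit]
    push_cast
    field_simp
    ring

lemma tendsto_prod_one_add_sq_div (β : ℂ) (hβ : β ≠ 0) :
    Tendsto (fun n : ℕ => ∏ j ∈ Finset.range n, (1 + β ^ 2 / ((j : ℂ) + 1) ^ 2)) atTop
      (𝓝 ((exp (β * Real.pi) - exp (-(β * Real.pi))) / (2 * β * Real.pi))) := by
  have hsin : sin (Real.pi * (β * I)) / (Real.pi * (β * I)) =
      (exp (β * Real.pi) - exp (-(β * Real.pi))) / (2 * β * Real.pi) := by
    have hπ : (Real.pi : ℂ) ≠ 0 := ofReal_ne_zero.2 Real.pi_ne_zero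
    rw [show Real.pi * (β * I) = β * Real.pi * I by ring, sin_mul_I, sinh]
    field_simp
  rw [← hsin]
  refine (tendsto_euler_sin_prod' (mul_ne_zero hβ I_ne_zero)).congr fun n => ?_
  refine Finset.prod_congr rfl fun j _ => ?_
  simp [sineTerm, mul_pow]

/-- (Choi–Lee–Srivastava) For every complex β with β ≠ 0, β ≠ ±i, the infinite product
∏_{k=1}^∞ e^{−2/k}(1 + 2/k + (β² + 1)/k²) converges and equals
(e^{βπ} − e^{−βπ}) / (2β(β² + 1) π e^{2γ}). -/
theorem choi_lee_srivastava_product_two (β : ℂ) (h₀ : β ≠ 0) (h₁ : β ≠ I) (h₂ : β ≠ -I) :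
    HasProd
      (fun k : ℕ => Complex.exp (-(2 / ((k : ℂ) + 1))) *
        (1 + 2 / ((k : ℂ) + 1) + (β ^ 2 + 1) / ((k : ℂ) + 1) ^ 2))
      ((Complex.exp (β * Real.pi) - Complex.exp (-(β * Real.pi))) /
        (2 * β * (β ^ 2 + 1) * Real.pi *
          Complex.exp (2 * (Real.eulerMascheroniConstant : ℂ)))) := by
  have hβ : β ^ 2 + 1 ≠ 0 := by
    rw [show β ^ 2 + 1 = (β - I) * (β + I) by ring_nf; simp [add_comm]]
    exact mul_ne_zero (sub_ne_zero.2 h₁) (fun h => h₂ (eq_neg_of_add_eq_zero_left h))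
  have hγ : Tendsto (fun n => exp (-(2 * (Real.eulerMascheroniSeq n : ℂ)))) atTop
      (𝓝 (exp (-(2 * (Real.eulerMascheroniConstant : ℂ))))) :=
    (continuous_exp.tendsto _).comp
      (((continuous_ofReal.tendsto _).comp Real.tendsto_eulerMascheroniSeq).const_mul 2).neg
  have hlim := hγ.mul (((tendsto_prod_one_add_sq_div β h₀).comp
    (tendsto_add_atTop_nat 1)).div_const (β ^ 2 + 1))
  have hprod := (multipliable_exp_neg_two_div_mul_quadratic (β ^ 2 + 1)).hasProd
  have heq := tendsto_nhds_unique hprod.tendsto_prod_nat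
    (hlim.congr fun n => (prod_range_exp_neg_two_div_mul_quadratic β hβ n).symm)
  rw [heq] at hprod
  convert hprod using 1
  rw [exp_neg (2 * (Real.eulerMascheroniConstant : ℂ))]
  field_simp
end

section
/- (Jacobi's identity) For every τ in the upper half plane ℍ, with q = e^{2πiτ}, the discriminant Δ(τ) = g₂(τ)³ − 27 g₃(τ)² satisfies Δ(τ) = (2π)^{12} · q · ∏_{n=1}^∞ (1 − q^n)^{24}, where the infinite product converges. -/
/-- A nonzero lattice point mτ + n of the lattice L_τ = ℤ + ℤτ,
indexed by (m, n) ∈ ℤ × ℤ, (m, n) ≠ (0, 0). -/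
noncomputable def latPt (τ : ℂ) (p : ℤ × ℤ) : ℂ := (p.1 : ℂ) * τ + (p.2 : ℂ)

/-- g₂(τ) = 60 Σ_{ω ∈ L_τ, ω ≠ 0} ω⁻⁴. -/
noncomputable def gTwo (τ : ℂ) : ℂ := 60 * ∑' p : {p : ℤ × ℤ // p ≠ 0}, 1 / latPt τ p.1 ^ 4

/-- g₃(τ) = 140 Σ_{ω ∈ L_τ, ω ≠ 0} ω⁻⁶. -/
noncomputable def gThree (τ : ℂ) : ℂ := 140 * ∑' p : {p : ℤ × ℤ // p ≠ 0}, 1 / latPt τ p.1 ^ 6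

open ModularForm EisensteinSeries in
/-- The full lattice sum of weight `k` over `ℤ + ℤτ` is `2 ζ(k)` times the normalised
Eisenstein series. -/
lemma tsum_one_div_latPt_pow (z : UpperHalfPlane) {k : ℕ} (hk : 3 ≤ k) :
    ∑' p : {p : ℤ × ℤ // p ≠ 0}, 1 / latPt z p.1 ^ k = 2 * riemannZeta k * E hk z := by
  have hE : E hk z = (1 / 2 : ℂ) • eisensteinSeriesSIF (N := 1) 0 k z := rfl
  have hsupp : Function.support (fun p : ℤ × ℤ => 1 / latPt z p ^ k) ⊆ {p | p ≠ 0} := by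
    rintro p hp rfl
    exact hp (by simp [latPt, show k ≠ 0 by omega])
  have hsub : ∑' p : {p : ℤ × ℤ // p ≠ 0}, 1 / latPt z p.1 ^ k =
      ∑' p : ℤ × ℤ, 1 / latPt z p ^ k := tsum_subtype_eq_of_support_subset hsupp
  have hfin : ∑' p : ℤ × ℤ, 1 / latPt z p ^ k = ∑' v : Fin 2 → ℤ, eisSummand k v z := by
    rw [← (finTwoArrowEquiv ℤ).tsum_eq]
    simp [eisSummand, latPt]
  rw [hsub, hfin, tsum_eisSummand_eq_riemannZeta_mul_eisensteinSeries hk z, hE,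
    eisensteinSeriesSIF_apply, smul_eq_mul]
  ring

lemma riemannZeta_six : riemannZeta 6 = Real.pi ^ 6 / 945 := by
  have hB : bernoulli 6 = 1 / 42 := by
    rw [bernoulli_eq_bernoulli'_of_ne_one (by norm_num), bernoulli'_def]
    norm_num [Finset.sum_range_succ, Nat.choose,
      bernoulli'_eq_zero_of_odd (n := 5) (by decide) (by norm_num)]
  have h := riemannZeta_two_mul_nat (k := 3) (by norm_num)
  norm_num [hB, Nat.factorial] at h
  rw [h]
  ring

/-- (Jacobi's identity) For τ in the upper half plane and q = e^{2πiτ}, the discriminant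
Δ(τ) = g₂(τ)³ − 27 g₃(τ)² satisfies Δ(τ) = (2π)^{12} · q · ∏_{n=1}^∞ (1 − qⁿ)^{24},
the infinite product being convergent. -/
theorem jacobi_identity (τ : ℂ) (hτ : 0 < τ.im) :
    ∃ P : ℂ,
      HasProd (fun n : ℕ => (1 - Complex.exp (2 * Real.pi * Complex.I * τ) ^ (n + 1)) ^ 24) P ∧
      gTwo τ ^ 3 - 27 * gThree τ ^ 2 =
        (2 * Real.pi : ℂ) ^ 12 * Complex.exp (2 * Real.pi * Complex.I * τ) * P := by
  let z : UpperHalfPlane := ⟨τ, hτ⟩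
  have hq : ‖Complex.exp (2 * Real.pi * Complex.I * τ)‖ < 1 :=
    UpperHalfPlane.norm_exp_two_pi_I_lt_one z
  refine ⟨_, ((ModularForm.multipliable_one_sub_pow hq).pow 24).hasProd, ?_⟩
  have hprod : ModularForm.discriminant z = Complex.exp (2 * Real.pi * Complex.I * τ) *
      ∏' n : ℕ, (1 - Complex.exp (2 * Real.pi * Complex.I * τ) ^ (n + 1)) ^ 24 := by
    rw [ModularForm.discriminant_eq_q_prod]
    simp [z, ModularForm.eta_q_eq_pow, Function.Periodic.qParam]
  have hTwo : gTwo τ = 4 * Real.pi ^ 4 / 3 * ModularForm.E₄ z := by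
    have h := tsum_one_div_latPt_pow z (k := 4) (by norm_num)
    rw [Nat.cast_ofNat, riemannZeta_four] at h
    rw [gTwo]
    linear_combination 60 * h
  have hThree : gThree τ = 8 * Real.pi ^ 6 / 27 * ModularForm.E₆ z := by
    have h := tsum_one_div_latPt_pow z (k := 6) (by norm_num)
    rw [Nat.cast_ofNat, riemannZeta_six] at h
    rw [gThree]
    linear_combination 140 * h
  rw [mul_assoc, ← hprod, ModularForm.discriminant_eq_E₄_cube_sub_E₆_sq, hTwo, hThree]
  ring
end
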